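/- arXiv:2412.14002 — 2 statements merged into one kernel-verified Lean document; each statement's English description precedes it below -/
import Mathlib

section
/- Let S and A be positive integers, γ ∈ (0,1), P ∈ ℝ^{SA×S} row-stochastic, ρ ∈ ℝ^S a probability vector, Ξ = 1_A ⊗ I_S, c ∈ ℝ^{SA}, σ > 0, and let D be the occupancy polytope. Let C ⊆ ℝ^{SA} be nonempty, closed and convex, and assume either (i) D ∩ rint C ≠ ∅ where rint denotes the relative (intrinsic) interior, or (ii) C = {d : Ed ≤ b} for some matrix E and vector b, and D ∩ C ≠ ∅. Given w_0 ∈ ℝ^{SA}, define the Douglas–Rachford iterates for k ∈ ℕ: d_k is the unique minimizer of c^⊤ d + (1/(2σ))‖d − w_k‖² over D; ν_k = (w_k − d_k)/σ; z_k is the unique nearest point of C to 2d_k − w_k; w_{k+1} = w_k + (z_k − d_k). Then there exist d* ∈ C ∩ D and ν* ∈ ℝ^{SA} such that (d_k, z_k, ν_k) → (d*, d*, ν*), where d* minimizes c^⊤ d over C ∩ D, and ν* satisfies: c^⊤ d ≥ c^⊤ d* + ν*^⊤(d − d*) for all d ∈ D, and ν*^⊤(z − d*) ≥ 0 for all z ∈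 C. -/
open Matrix Filter Topology

noncomputable def eucNorm {ι : Type*} [Fintype ι] (x : ι → ℝ) : ℝ :=
  Real.sqrt (∑ i, x i ^ 2)

def RowStochastic {m n : Type*} [Fintype n] (P : Matrix m n ℝ) : Prop :=
  (∀ i j, 0 ≤ P i j) ∧ ∀ i, ∑ j, P i j = 1

def Xi (S A : ℕ) : Matrix (Fin S × Fin A) (Fin S) ℝ :=
  Matrix.of fun p s' => if p.1 = s' then 1 else 0

def OccD (S A : ℕ) (γ : ℝ) (P : Matrix (Fin S × Fin A) (Fin S) ℝ)
    (ρ : Fin S → ℝ) : Set ((Fin S × Fin A) → ℝ) :=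
  {d | (∀ p, 0 ≤ d p) ∧
    ∀ s, ∑ a, d (s, a) = (1 - γ) * ρ s + γ * ∑ p : Fin S × Fin A, P p s * d p}

noncomputable def kappa (S A : ℕ) (γ σ : ℝ) (P : Matrix (Fin S × Fin A) (Fin S) ℝ)
    (ρ : Fin S → ℝ) (c w : (Fin S × Fin A) → ℝ)
    (V : Fin S → ℝ) (φ : (Fin S × Fin A) → ℝ) : ℝ :=
  -(σ / 2) * eucNorm (c + γ • P.mulVec V - (Xi S A).mulVec V - φ) ^ 2
    + ∑ p, w p * (c + γ • P.mulVec V - (Xi S A).mulVec V - φ) p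
    + (1 - γ) * ∑ s, ρ s * V s

noncomputable def regObj {ι : Type*} [Fintype ι] (σ : ℝ) (c w d : ι → ℝ) : ℝ :=
  (∑ p, c p * d p) + (1 / (2 * σ)) * eucNorm (d - w) ^ 2

/-- **Farkas' lemma** for finitely many linear functionals. -/
theorem farkas_finset {V J : Type*} [AddCommGroup V] [Module ℝ V] (s : Finset J) :
    ∀ (a : J → Module.Dual ℝ V) (f : Module.Dual ℝ V),
      (∀ x, (∀ j ∈ s, 0 ≤ a j x) → 0 ≤ f x) →
      ∃ l : J → ℝ, (∀ j, 0 ≤ l j) ∧ f = ∑ j ∈ s, l j • a j := by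
  classical
  induction s using Finset.induction_on with
  | empty =>
    intro a f h
    refine ⟨0, fun _ => le_rfl, ?_⟩
    ext x
    have h1 := h x (by simp)
    have h2 := h (-x) (by simp)
    rw [map_neg] at h2
    simp only [Finset.sum_empty, LinearMap.zero_apply]
    linarith
  | insert m s hm ih =>
    intro a f h
    by_cases hs : ∀ x, (∀ j ∈ s, 0 ≤ a j x) → 0 ≤ f x
    · obtain ⟨l, hl, hf⟩ := ih a f hs
      refine ⟨fun j => if j = m then 0 else l j, fun j => ?_, ?_⟩
      · dsimp only
        split_ifs
        exacts [le_rfl, hl j]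
      · rw [Finset.sum_insert hm, hf]
        simp only [if_true, zero_smul, zero_add]
        refine Finset.sum_congr rfl fun j hj => ?_
        rw [if_neg (ne_of_mem_of_not_mem hj hm)]
    · push Not at hs
      obtain ⟨y, hy, hfy⟩ := hs
      have hmy : a m y < 0 := by
        by_contra! hc
        refine absurd (h y fun j hj => ?_) (not_le.2 hfy)
        rcases Finset.mem_insert.1 hj with rfl | hj
        exacts [hc, hy j hj]
      set x₁ : V := (-(a m y))⁻¹ • y with hx₁
      have hpos : 0 < (-(a m y))⁻¹ := by
        rw [inv_pos]
        linarith
      have hm1 : a m x₁ = -1 := by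
        rw [hx₁, map_smul, smul_eq_mul]
        field_simp [hmy.ne]
      have hf1 : f x₁ < 0 := by
        rw [hx₁, map_smul, smul_eq_mul]
        exact mul_neg_of_pos_of_neg hpos hfy
      have ha1 : ∀ j ∈ s, 0 ≤ a j x₁ := fun j hj => by
        rw [hx₁, map_smul, smul_eq_mul]
        exact mul_nonneg hpos.le (hy j hj)
      obtain ⟨l, hl, hf⟩ := ih (fun j => a j + a j x₁ • a m) (f + f x₁ • a m) (by
        intro x hx
        have key := h (x + a m x • x₁) (fun j hj => by
          rcases Finset.mem_insert.1 hj with rfl | hj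
          · simp [hm1]
          · have := hx j hj
            simp only [LinearMap.add_apply, LinearMap.smul_apply, smul_eq_mul] at this
            simp only [map_add, map_smul, smul_eq_mul]
            linarith)
        simp only [map_add, map_smul, smul_eq_mul] at key
        simp only [LinearMap.add_apply, LinearMap.smul_apply, smul_eq_mul]
        linarith)
      refine ⟨fun j => if j = m then (∑ i ∈ s, l i * a i x₁) - f x₁ else l j, fun j => ?_, ?_⟩
      · dsimp only
        split_ifs
        · have := Finset.sum_nonneg fun i hi => mul_nonneg (hl i) (ha1 i hi)
          linarith
        · exact hl j
      · rw [Finset.sum_insert hm]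
        simp only [if_true]
        have h1 : ∑ j ∈ s, (if j = m then (∑ i ∈ s, l i * a i x₁) - f x₁ else l j) • a j
            = ∑ j ∈ s, l j • a j :=
          Finset.sum_congr rfl fun j hj => by rw [if_neg (ne_of_mem_of_not_mem hj hm)]
        rw [h1]
        ext x
        have h2 := LinearMap.congr_fun hf x
        simp only [LinearMap.add_apply, LinearMap.smul_apply, smul_eq_mul, LinearMap.sum_apply,
          mul_add, Finset.sum_add_distrib] at h2 ⊢
        rw [show ∑ j ∈ s, l j * (a j x₁ * a m x) = (∑ j ∈ s, l j * a j x₁) * a m x by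
          rw [Finset.sum_mul]; simp only [mul_assoc]] at h2
        linarith

/-- A finite intersection of closed half-spaces. -/
def IsPolyhedron {V : Type*} [AddCommGroup V] [Module ℝ V] (D : Set V) : Prop :=
  ∃ (J : Type) (_ : Fintype J) (a : J → Module.Dual ℝ V) (b : J → ℝ), D = {x | ∀ j, b j ≤ a j x}

theorem IsPolyhedron.inter {V : Type*} [AddCommGroup V] [Module ℝ V] {D₁ D₂ : Set V}
    (h₁ : IsPolyhedron D₁) (h₂ : IsPolyhedron D₂) : IsPolyhedron (D₁ ∩ D₂) := by
  obtain ⟨J₁, _, a₁, b₁, rfl⟩ := h₁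
  obtain ⟨J₂, _, a₂, b₂, rfl⟩ := h₂
  refine ⟨J₁ ⊕ J₂, inferInstance, Sum.elim a₁ a₂, Sum.elim b₁ b₂, ?_⟩
  ext x
  simp

theorem IsPolyhedron.of_forall_le {V J : Type} [AddCommGroup V] [Module ℝ V] [Fintype J]
    (a : J → Module.Dual ℝ V) (b : J → ℝ) : IsPolyhedron {x | ∀ j, b j ≤ a j x} :=
  ⟨J, inferInstance, a, b, rfl⟩

theorem IsPolyhedron.of_forall_eq {V J : Type} [AddCommGroup V] [Module ℝ V] [Fintype J]
    (a : J → Module.Dual ℝ V) (b : J → ℝ) : IsPolyhedron {x | ∀ j, a j x = b j} := by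
  convert (IsPolyhedron.of_forall_le a b).inter (IsPolyhedron.of_forall_le (-a) (-b)) using 1
  ext x
  simp only [Set.mem_ofPred_eq, Set.mem_inter_iff, Pi.neg_apply, LinearMap.neg_apply,
    neg_le_neg_iff, ← forall_and]
  exact forall_congr' fun j => ⟨fun h => ⟨h.ge, h.le⟩, fun h => le_antisymm h.2 h.1⟩

theorem IsPolyhedron.setOf_sub_mem {V : Type} [AddCommGroup V] [Module ℝ V]
    [FiniteDimensional ℝ V] (W : Submodule ℝ V) (x₀ : V) :
    IsPolyhedron {x | x - x₀ ∈ W} := by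
  let B := Module.finBasis ℝ (V ⧸ W)
  convert IsPolyhedron.of_forall_eq (fun j => (B.coord j).comp W.mkQ)
    (fun j => B.coord j (W.mkQ x₀)) using 1
  ext x
  simp only [Set.mem_ofPred_eq, LinearMap.comp_apply]
  rw [← Submodule.Quotient.mk_eq_zero, Submodule.Quotient.mk_sub, sub_eq_zero]
  exact B.ext_elem_iff

/-- A linear functional minimised at `x` over an intersection of two polyhedra splits
into functionals minimised at `x` over each of them. -/
theorem IsPolyhedron.exists_split {V : Type*} [AddCommGroup V] [Module ℝ V] {D₁ D₂ : Set V}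
    (h₁ : IsPolyhedron D₁) (h₂ : IsPolyhedron D₂) {x : V} (hx₁ : x ∈ D₁) (hx₂ : x ∈ D₂)
    (f : Module.Dual ℝ V) (hf : ∀ y ∈ D₁ ∩ D₂, f x ≤ f y) :
    ∃ h : Module.Dual ℝ V, (∀ y ∈ D₁, 0 ≤ (f - h) (y - x)) ∧ ∀ y ∈ D₂, 0 ≤ h (y - x) := by
  classical
  obtain ⟨J₁, _, a₁, b₁, rfl⟩ := h₁
  obtain ⟨J₂, _, a₂, b₂, rfl⟩ := h₂
  set a : J₁ ⊕ J₂ → Module.Dual ℝ V := Sum.elim a₁ a₂ with ha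
  set b : J₁ ⊕ J₂ → ℝ := Sum.elim b₁ b₂ with hb
  obtain ⟨l, hl, hfl⟩ := farkas_finset (Finset.univ.filter fun j => a j x = b j) a f (by
    intro v hv
    have hev : ∀ᶠ t : ℝ in 𝓝[>] 0, ∀ j, b j ≤ a j (x + t • v) := by
      rw [Filter.eventually_all]
      intro j
      by_cases hj : a j x = b j
      · filter_upwards [self_mem_nhdsWithin] with t ht
        have := hv j (by simpa using hj)
        simp only [map_add, map_smul, smul_eq_mul, hj]
        have := mul_nonneg (le_of_lt (Set.mem_Ioi.1 ht)) this
        linarith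
      · have hlt : b j < a j x := by
          refine lt_of_le_of_ne ?_ (Ne.symm hj)
          cases j with
          | inl j => exact hx₁ j
          | inr j => exact hx₂ j
        have hc : Tendsto (fun t : ℝ => a j (x + t • v)) (𝓝[>] 0) (𝓝 (a j x)) := by
          have : Continuous fun t : ℝ => a j (x + t • v) := by
            simp only [map_add, map_smul, smul_eq_mul]
            fun_prop
          have h0 := this.tendsto 0
          simp only [zero_smul, add_zero] at h0
          exact h0.mono_left nhdsWithin_le_nhds
        filter_upwards [hc.eventually (lt_mem_nhds hlt)] with t ht using ht.le
    obtain ⟨t, ht, ht0⟩ := (hev.and self_mem_nhdsWithin).exists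
    have := hf (x + t • v) ⟨fun j => ht (Sum.inl j), fun j => ht (Sum.inr j)⟩
    simp only [map_add, map_smul, smul_eq_mul] at this
    exact nonneg_of_mul_nonneg_right (by linarith) (Set.mem_Ioi.1 ht0))
  have hnn : ∀ j y, b j ≤ a j y → 0 ≤ (if a j x = b j then l j * a j (y - x) else 0) := by
    intro j y hy
    split_ifs with hj
    · refine mul_nonneg (hl j) ?_
      rw [map_sub]
      linarith
    · exact le_rfl
  have hsum : ∀ v, f v = (∑ j, if a₁ j x = b₁ j then l (Sum.inl j) * a₁ j v else 0)
      + ∑ j, if a₂ j x = b₂ j then l (Sum.inr j) * a₂ j v else 0 := by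
    intro v
    rw [hfl, LinearMap.sum_apply, Finset.sum_filter, Fintype.sum_sum_type]
    simp [ha, hb]
  have hval : ∀ v, (∑ j, if a₂ j x = b₂ j then l (Sum.inr j) • a₂ j else 0) v
      = ∑ j, if a₂ j x = b₂ j then l (Sum.inr j) * a₂ j v else 0 := by
    intro v
    rw [LinearMap.sum_apply]
    refine Finset.sum_congr rfl fun j _ => ?_
    split_ifs <;> simp
  refine ⟨∑ j, if a₂ j x = b₂ j then l (Sum.inr j) • a₂ j else 0, fun y hy => ?_, fun y hy => ?_⟩
  · rw [LinearMap.sub_apply, hval, hsum, add_sub_cancel_right]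
    exact Finset.sum_nonneg fun j _ => hnn (Sum.inl j) y (hy j)
  · rw [hval]
    exact Finset.sum_nonneg fun j _ => hnn (Sum.inr j) y (hy j)

/-- Splitting under the condition that `D` meets the interior of `C`. -/
theorem exists_split_of_mem_interior {V : Type*} [NormedAddCommGroup V] [NormedSpace ℝ V]
    [FiniteDimensional ℝ V] {C D : Set V} (hC : Convex ℝ C) (hD : Convex ℝ D)
    {x₀ x : V} (hx₀C : x₀ ∈ interior C) (hx₀D : x₀ ∈ D) (hxC : x ∈ C) (hxD : x ∈ D)
    (f : Module.Dual ℝ V) (hf : ∀ y ∈ C ∩ D, f x ≤ f y) :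
    ∃ h : Module.Dual ℝ V, (∀ y ∈ C, 0 ≤ (f - h) (y - x)) ∧ ∀ y ∈ D, 0 ≤ h (y - x) := by
  have hfc : Continuous f := f.continuous_of_finiteDimensional
  let s : Set (V × ℝ) := {p | p.1 ∈ interior C ∧ f p.1 - f x < p.2}
  let t : Set (V × ℝ) := {p | p.1 ∈ D ∧ p.2 ≤ 0}
  have hs : Convex ℝ s := by
    rintro ⟨y, a⟩ ⟨hy, ha⟩ ⟨z, b⟩ ⟨hz, hb⟩ p q hp hq hpq
    refine ⟨hC.interior hy hz hp hq hpq, ?_⟩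
    simp only [Prod.smul_mk, Prod.mk_add_mk, map_add, map_smul, smul_eq_mul] at ha hb ⊢
    obtain rfl : q = 1 - p := by linarith
    rcases hp.eq_or_lt with rfl | hp
    · linarith
    · nlinarith [mul_pos hp (sub_pos.2 ha), mul_nonneg hq (sub_pos.2 hb).le]
  have hso : IsOpen s := by
    refine (isOpen_interior.preimage continuous_fst).inter (isOpen_lt ?_ continuous_snd)
    exact (hfc.comp continuous_fst).sub continuous_const
  have ht : Convex ℝ t := by
    rintro ⟨y, a⟩ ⟨hy, ha⟩ ⟨z, b⟩ ⟨hz, hb⟩ p q hp hq hpq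
    refine ⟨hD hy hz hp hq hpq, ?_⟩
    simp only [Prod.smul_mk, Prod.mk_add_mk, smul_eq_mul] at ha hb ⊢
    nlinarith [mul_nonneg hp (neg_nonneg.2 ha), mul_nonneg hq (neg_nonneg.2 hb)]
  have hst : Disjoint s t := by
    rw [Set.disjoint_left]
    rintro ⟨y, a⟩ ⟨hy, ha⟩ ⟨hy', ha'⟩
    have := hf y ⟨interior_subset hy, hy'⟩
    dsimp only at ha ha'
    linarith
  obtain ⟨φ, u, hφs, hφt⟩ := geometric_hahn_banach_open hs hso ht hst
  set τ : ℝ := φ (0, 1)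
  let ψ : V →L[ℝ] ℝ := φ.comp (ContinuousLinearMap.inl ℝ V ℝ)
  have hφ : ∀ y a, φ (y, a) = ψ y + a * τ := by
    intro y a
    rw [show (y, a) = (y, (0 : ℝ)) + a • ((0 : V), (1 : ℝ)) by simp, map_add, map_smul]
    rfl
  have hsep : ∀ y ∈ interior C, ∀ z ∈ D, ∀ ε > 0, ψ y + (f y - f x + ε) * τ < ψ z := by
    intro y hy z hz ε hε
    have h1 := hφs (y, f y - f x + ε) ⟨hy, by dsimp only; linarith⟩
    have h2 := hφt (z, 0) ⟨hz, le_rfl⟩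
    rw [hφ] at h1 h2
    linarith
  have hτneg : τ < 0 := by
    have h1 := hsep x₀ hx₀C x₀ hx₀D 1 one_pos
    have h2 := hf x₀ ⟨interior_subset hx₀C, hx₀D⟩
    nlinarith
  have hsep' : ∀ y ∈ C, ∀ z ∈ D, ψ y + (f y - f x) * τ ≤ ψ z := by
    intro y hy z hz
    have hcl : IsClosed {y | ψ y + (f y - f x) * τ ≤ ψ z} :=
      isClosed_le (by fun_prop) continuous_const
    have hsub : interior C ⊆ {y | ψ y + (f y - f x) * τ ≤ ψ z} := by
      intro y hy
      change ψ y + (f y - f x) * τ ≤ ψ z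
      refine le_of_forall_pos_le_add fun ε hε => ?_
      have h1 := hsep y hy z hz (ε / -τ) (div_pos hε (by linarith))
      have h2 : ε / -τ * τ = -ε := by
        rw [div_neg, neg_mul, div_mul_cancel₀ _ hτneg.ne]
      rw [add_mul, h2] at h1
      linarith
    refine closure_minimal hsub hcl ?_
    rw [hC.closure_interior_eq_closure_of_nonempty_interior ⟨x₀, hx₀C⟩]
    exact subset_closure hy
  have hpos : 0 < (-τ)⁻¹ := inv_pos.2 (by linarith)
  refine ⟨(-τ)⁻¹ • (ψ : V →ₗ[ℝ] ℝ), fun y hy => ?_, fun z hz => ?_⟩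
  · have h1 := hsep' y hy x hxD
    have h2 : (-τ)⁻¹ * (ψ x - (ψ y + (f y - f x) * τ))
        = (f y - f x) - (-τ)⁻¹ * (ψ y - ψ x) := by
      have hτ0 := hτneg.ne
      field_simp
      ring
    simp only [LinearMap.sub_apply, LinearMap.smul_apply, ContinuousLinearMap.coe_coe, map_sub,
      smul_eq_mul]
    have h3 := mul_nonneg hpos.le (sub_nonneg.2 h1)
    linarith
  · have h1 := hsep' x hxC z hz
    rw [LinearMap.smul_apply, ContinuousLinearMap.coe_coe, map_sub, smul_eq_mul]
    refine mul_nonneg hpos.le ?_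
    simp only [sub_self, zero_mul, add_zero] at h1
    linarith

theorem IsPolyhedron.convex {V : Type*} [AddCommGroup V] [Module ℝ V] {D : Set V}
    (hD : IsPolyhedron D) : Convex ℝ D := by
  obtain ⟨J, _, a, b, rfl⟩ := hD
  intro x hx y hy p q hp hq hpq j
  simp only [map_add, map_smul, smul_eq_mul]
  have h1 := mul_le_mul_of_nonneg_left (hx j) hp
  have h2 := mul_le_mul_of_nonneg_left (hy j) hq
  calc b j = p * b j + q * b j := by rw [← add_mul, hpq, one_mul]
    _ ≤ _ := add_le_add h1 h2

/-- Splitting under the condition that a polyhedron `D` meets the relative interior of `C`. -/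
theorem IsPolyhedron.exists_split_of_mem_intrinsicInterior {V : Type}
    [NormedAddCommGroup V] [NormedSpace ℝ V]
    [FiniteDimensional ℝ V] {C D : Set V} (hC : Convex ℝ C) (hD : IsPolyhedron D)
    {x₀ x : V} (hx₀C : x₀ ∈ intrinsicInterior ℝ C) (hx₀D : x₀ ∈ D) (hxC : x ∈ C) (hxD : x ∈ D)
    (f : Module.Dual ℝ V) (hf : ∀ y ∈ C ∩ D, f x ≤ f y) :
    ∃ h : Module.Dual ℝ V, (∀ y ∈ C, 0 ≤ (f - h) (y - x)) ∧ ∀ y ∈ D, 0 ≤ h (y - x) := by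
  set W := (affineSpan ℝ C).direction
  have hx₀ : x₀ ∈ C := intrinsicInterior_subset hx₀C
  have hx₀S : x₀ ∈ affineSpan ℝ C := subset_affineSpan ℝ C hx₀
  have hCW : ∀ y ∈ C, y - x₀ ∈ W := fun y hy =>
    AffineSubspace.vsub_mem_direction (subset_affineSpan ℝ C hy) hx₀S
  obtain ⟨U, hU, hx₀U, hUC⟩ : ∃ U : Set V, IsOpen U ∧ x₀ ∈ U ∧
      ∀ y ∈ U, y - x₀ ∈ W → y ∈ C := by
    obtain ⟨y, hy, hyx⟩ := mem_intrinsicInterior.1 hx₀C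
    obtain ⟨O, hOC, hO, hyO⟩ := mem_interior.1 hy
    obtain ⟨U, hU, rfl⟩ := isOpen_induced_iff.1 hO
    refine ⟨U, hU, hyx ▸ hyO, fun z hz hzW => ?_⟩
    have hzS : z ∈ affineSpan ℝ C := by
      have := AffineSubspace.vadd_mem_of_mem_direction hzW hx₀S
      simpa using this
    exact @hOC ⟨z, hzS⟩ hz
  obtain ⟨W', hWW'⟩ := W.exists_isCompl
  set π : V →ₗ[ℝ] V := W.projection W' hWW'
  have hπW : ∀ v ∈ W, π v = v := fun v hv => Submodule.projection_apply_of_mem_left hWW' hv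
  have hπm : ∀ v, π v ∈ W := Submodule.projection_apply_mem hWW'
  have hπc : Continuous π := π.continuous_of_finiteDimensional
  let C' : Set V := {y | x₀ + π (y - x₀) ∈ C}
  let L : Set V := {y | y - x₀ ∈ W}
  have hC' : Convex ℝ C' := by
    intro y hy z hz p q hp hq hpq
    have h := hC hy hz hp hq hpq
    change x₀ + π (p • y + q • z - x₀) ∈ C
    convert h using 1
    obtain rfl : q = 1 - p := by linarith
    simp only [map_sub, map_add, map_smul]
    module
  have hCC' : C ⊆ C' := fun y hy => by
    change x₀ + π (y - x₀) ∈ C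
    rwa [hπW _ (hCW y hy), add_sub_cancel]
  have hL : IsPolyhedron L := IsPolyhedron.setOf_sub_mem W x₀
  have hCL : C ⊆ L := hCW
  have hx₀C' : x₀ ∈ interior C' := by
    refine mem_interior.2 ⟨(fun y => x₀ + π (y - x₀)) ⁻¹' U, fun y hy => ?_,
      hU.preimage (by fun_prop), ?_⟩
    · exact hUC _ hy (by simpa using hπm (y - x₀))
    · simpa using hx₀U
  obtain ⟨h, hCh, hDh⟩ := exists_split_of_mem_interior hC' (hL.inter hD).convex hx₀C'
    ⟨hCL hx₀, hx₀D⟩ (hCC' hxC) ⟨hCL hxC, hxD⟩ f (by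
      rintro y ⟨hyC', hyL, hyD⟩
      refine hf y ⟨?_, hyD⟩
      have h1 : x₀ + π (y - x₀) ∈ C := hyC'
      rwa [hπW _ hyL, add_sub_cancel] at h1)
  obtain ⟨g, hgL, hgD⟩ := hL.exists_split hD (hCL hxC) hxD h (fun y hy => by
    have := hDh y hy
    rw [map_sub] at this
    linarith)
  refine ⟨g, fun y hy => ?_, hgD⟩
  have h1 := hCh y (hCC' hy)
  have h2 := hgL y (hCL hy)
  rw [LinearMap.sub_apply] at h1 h2 ⊢
  linarith

theorem eucNorm_sq {ι : Type*} [Fintype ι] (x : ι → ℝ) : eucNorm x ^ 2 = x ⬝ᵥ x := by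
  rw [eucNorm, Real.sq_sqrt (Finset.sum_nonneg fun i _ => sq_nonneg _)]
  simp only [dotProduct, sq]

theorem dotProduct_self_nonneg_real {ι : Type*} [Fintype ι] (x : ι → ℝ) : 0 ≤ x ⬝ᵥ x :=
  Finset.sum_nonneg fun i _ => mul_self_nonneg (x i)

theorem tendsto_zero_of_dotProduct_self {ι : Type*} [Fintype ι] {u : ℕ → ι → ℝ}
    (h : Tendsto (fun k => u k ⬝ᵥ u k) atTop (𝓝 0)) : Tendsto u atTop (𝓝 0) := by
  rw [tendsto_pi_nhds]
  intro i
  have hsq : Tendsto (fun k => √(u k ⬝ᵥ u k)) atTop (𝓝 0) := by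
    simpa [Function.comp_def] using (Real.continuous_sqrt.tendsto 0).comp h
  refine squeeze_zero_norm (fun k => ?_) hsq
  refine Real.le_sqrt_of_sq_le ?_
  rw [Real.norm_eq_abs, sq_abs, sq]
  exact Finset.single_le_sum (f := fun i => u k i * u k i) (fun j _ => mul_self_nonneg _)
    (Finset.mem_univ i)

/-- First-order optimality for a convex quadratic minimised over a convex set. -/
theorem dotProduct_nonneg_of_isMinOn {ι : Type*} [Fintype ι] {D : Set (ι → ℝ)} (hD : Convex ℝ D)
    (c w x : ι → ℝ) (β : ℝ) (hx : x ∈ D)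
    (hmin : ∀ y ∈ D, c ⬝ᵥ x + β * ((x - w) ⬝ᵥ (x - w)) ≤ c ⬝ᵥ y + β * ((y - w) ⬝ᵥ (y - w))) :
    ∀ y ∈ D, 0 ≤ (c + (2 * β) • (x - w)) ⬝ᵥ (y - x) := by
  intro y hy
  set g : ℝ := (c + (2 * β) • (x - w)) ⬝ᵥ (y - x) with hg
  set q : ℝ := β * ((y - x) ⬝ᵥ (y - x)) with hq
  have hstep : ∀ t : ℝ, 0 < t → t ≤ 1 → 0 ≤ g + t * q := by
    intro t ht0 ht1
    have h1 := hmin (x + t • (y - x)) (hD.add_smul_sub_mem hx hy ⟨ht0.le, ht1⟩)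
    have hexp : c ⬝ᵥ (x + t • (y - x))
        + β * ((x + t • (y - x) - w) ⬝ᵥ (x + t • (y - x) - w))
        = c ⬝ᵥ x + β * ((x - w) ⬝ᵥ (x - w)) + t * (g + t * q) := by
      rw [hg, hq, show x + t • (y - x) - w = (x - w) + t • (y - x) by abel]
      simp only [add_dotProduct, dotProduct_add, smul_dotProduct, dotProduct_smul, smul_eq_mul]
      rw [dotProduct_comm (y - x) (x - w)]
      ring
    rw [hexp] at h1
    exact nonneg_of_mul_nonneg_right (by linarith) ht0
  have hlim : Tendsto (fun t : ℝ => g + t * q) (𝓝[>] 0) (𝓝 g) := by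
    have : Continuous fun t : ℝ => g + t * q := by fun_prop
    have h0 := this.tendsto 0
    simp only [zero_mul, add_zero] at h0
    exact h0.mono_left nhdsWithin_le_nhds
  refine ge_of_tendsto hlim ?_
  filter_upwards [Ioc_mem_nhdsGT (zero_lt_one (α := ℝ))] with t ht using hstep t ht.1 ht.2

/-- `x` minimises `c` over `C ∩ D`, and `ν` certifies it. -/
def IsKKTPair {ι : Type*} [Fintype ι] (C D : Set (ι → ℝ)) (c x ν : ι → ℝ) : Prop :=
  x ∈ C ∧ x ∈ D ∧ (∀ y ∈ D, 0 ≤ (c - ν) ⬝ᵥ (y - x)) ∧ ∀ y ∈ C, 0 ≤ ν ⬝ᵥ (y - x)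

theorem IsKKTPair.of_exists_split {ι : Type*} [Fintype ι] {C D : Set (ι → ℝ)} {c x : ι → ℝ}
    (hxC : x ∈ C) (hxD : x ∈ D)
    (h : ∃ h : Module.Dual ℝ (ι → ℝ), (∀ y ∈ C, 0 ≤ (dotProductBilin ℝ ℝ c - h) (y - x)) ∧
      ∀ y ∈ D, 0 ≤ h (y - x)) : ∃ ν, IsKKTPair C D c x ν := by
  classical
  obtain ⟨h, hC, hD⟩ := h
  have hrep : ∀ v, h v = (fun i => h (Pi.single i 1)) ⬝ᵥ v := by
    intro v
    rw [LinearMap.pi_apply_eq_sum_univ h v, dotProduct]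
    refine Finset.sum_congr rfl fun i _ => ?_
    rw [smul_eq_mul, mul_comm]
    congr 2
    ext j
    simp [Pi.single_apply, eq_comm]
  refine ⟨c - fun i => h (Pi.single i 1), hxC, hxD, fun y hy => ?_, fun y hy => ?_⟩
  · rw [sub_sub_cancel, ← hrep]
    exact hD y hy
  · rw [sub_dotProduct, ← hrep]
    exact hC y hy

section DouglasRachford

variable {ι : Type*} [Fintype ι] {C D : Set (ι → ℝ)} {c : ι → ℝ} {σ : ℝ}

theorem IsKKTPair.prox_monotone {x ν w d : ι → ℝ} (hσ : 0 < σ) (h : IsKKTPair C D c x ν)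
    (hdD : d ∈ D) (hd : ∀ y ∈ D, 0 ≤ (c + (1 / σ) • (d - w)) ⬝ᵥ (y - d)) :
    (d - x) ⬝ᵥ (d - x) ≤ (w - (x + σ • ν)) ⬝ᵥ (d - x) := by
  have h1 := hd x h.2.1
  have h2 := h.2.2.1 d hdD
  have h3 : σ * ((c + (1 / σ) • (d - w)) ⬝ᵥ (x - d) + (c - ν) ⬝ᵥ (d - x))
      = (w - (x + σ • ν)) ⬝ᵥ (d - x) - (d - x) ⬝ᵥ (d - x) := by
    rw [← neg_sub d x]
    simp only [add_dotProduct, sub_dotProduct, smul_dotProduct, dotProduct_neg, smul_eq_mul,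
      mul_add]
    field_simp
    ring
  have h4 := mul_nonneg hσ.le (add_nonneg h1 h2)
  linarith

theorem IsKKTPair.fejer {x ν w d z : ι → ℝ} (hσ : 0 < σ) (h : IsKKTPair C D c x ν)
    (hdD : d ∈ D) (hd : ∀ y ∈ D, 0 ≤ (c + (1 / σ) • (d - w)) ⬝ᵥ (y - d))
    (hzC : z ∈ C) (hz : ∀ y ∈ C, 0 ≤ (z - ((2 : ℝ) • d - w)) ⬝ᵥ (y - z)) :
    (w + (z - d) - (x + σ • ν)) ⬝ᵥ (w + (z - d) - (x + σ • ν)) + (z - d) ⬝ᵥ (z - d)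
      ≤ (w - (x + σ • ν)) ⬝ᵥ (w - (x + σ • ν)) := by
  have h1 := h.prox_monotone hσ hdD hd
  have h2 := hz x h.1
  have h3 := mul_nonneg hσ.le (h.2.2.2 z hzC)
  obtain ⟨a, rfl⟩ : ∃ a, w = a + (x + σ • ν) := ⟨w - (x + σ • ν), by abel⟩
  rw [add_sub_right_comm, add_sub_cancel_right] at *
  obtain ⟨p, rfl⟩ : ∃ p, d = x + p := ⟨d - x, by abel⟩
  obtain ⟨q, rfl⟩ : ∃ q, z = x + q := ⟨z - x, by abel⟩
  have e1 : x + q - ((2 : ℝ) • (x + p) - (a + (x + σ • ν))) = q + a + σ • ν - (2 : ℝ) • p := by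
    module
  rw [e1] at h2
  simp only [add_sub_cancel_left, sub_add_cancel_left, add_sub_add_left_eq_sub] at h1 h2 h3 ⊢
  simp only [add_dotProduct, sub_dotProduct, dotProduct_add, dotProduct_sub, dotProduct_neg,
    smul_dotProduct, smul_eq_mul] at h1 h2 h3 ⊢
  rw [dotProduct_comm q a, dotProduct_comm p a, dotProduct_comm q p]
  linarith

theorem douglasRachford_tendsto (hσ : 0 < σ) (hCc : IsClosed C) (hD : IsCompact D)
    {x₀ ν₀ : ι → ℝ} (h₀ : IsKKTPair C D c x₀ ν₀) {w d z : ℕ → ι → ℝ}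
    (hdD : ∀ k, d k ∈ D) (hd : ∀ k, ∀ y ∈ D, 0 ≤ (c + (1 / σ) • (d k - w k)) ⬝ᵥ (y - d k))
    (hzC : ∀ k, z k ∈ C) (hz : ∀ k, ∀ y ∈ C, 0 ≤ (z k - ((2 : ℝ) • d k - w k)) ⬝ᵥ (y - z k))
    (hw : ∀ k, w (k + 1) = w k + (z k - d k)) :
    ∃ x ν, IsKKTPair C D c x ν ∧ Tendsto d atTop (𝓝 x) ∧ Tendsto z atTop (𝓝 x) ∧
      Tendsto (fun k => (1 / σ) • (w k - d k)) atTop (𝓝 ν) := by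
  have hstep : ∀ {x ν}, IsKKTPair C D c x ν → ∀ k,
      (w (k + 1) - (x + σ • ν)) ⬝ᵥ (w (k + 1) - (x + σ • ν)) + (z k - d k) ⬝ᵥ (z k - d k)
        ≤ (w k - (x + σ • ν)) ⬝ᵥ (w k - (x + σ • ν)) := fun h k => by
    rw [hw k]
    exact h.fejer hσ (hdD k) (hd k) (hzC k) (hz k)
  have hanti : ∀ {x ν}, IsKKTPair C D c x ν →
      Antitone fun k => (w k - (x + σ • ν)) ⬝ᵥ (w k - (x + σ • ν)) := fun h =>
    antitone_nat_of_succ_le fun k => by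
      linarith [hstep h k, dotProduct_self_nonneg_real (z k - d k)]
  have hzd : Tendsto (fun k => z k - d k) atTop (𝓝 0) := by
    refine tendsto_zero_of_dotProduct_self ?_
    have hlim := tendsto_atTop_ciInf (hanti h₀)
      ⟨0, Set.forall_mem_range.2 fun k => dotProduct_self_nonneg_real _⟩
    have hdiff := hlim.sub (hlim.comp (tendsto_add_atTop_nat 1))
    rw [sub_self] at hdiff
    refine squeeze_zero (fun k => dotProduct_self_nonneg_real _) (fun k => ?_) hdiff
    have := hstep h₀ k
    simp only [Function.comp_apply]
    linarith
  obtain ⟨K, hK, hwK⟩ : ∃ K : Set (ι → ℝ), IsCompact K ∧ ∀ k, w k ∈ K := by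
    set R := √((w 0 - (x₀ + σ • ν₀)) ⬝ᵥ (w 0 - (x₀ + σ • ν₀))) with hR
    refine ⟨Metric.closedBall (x₀ + σ • ν₀) R, isCompact_closedBall _ _, fun k => ?_⟩
    rw [mem_closedBall_iff_norm, pi_norm_le_iff_of_nonneg (Real.sqrt_nonneg _)]
    intro i
    refine Real.le_sqrt_of_sq_le ((?_ : _ ≤ _).trans (hanti h₀ (Nat.zero_le k)))
    rw [Real.norm_eq_abs, sq_abs, sq]
    exact Finset.single_le_sum (f := fun i => (w k - (x₀ + σ • ν₀)) i * (w k - (x₀ + σ • ν₀)) i)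
      (fun j _ => mul_self_nonneg _) (Finset.mem_univ i)
  obtain ⟨⟨W, x⟩, ⟨-, hxD⟩, φ, hφ, hlim⟩ :=
    (hK.prod hD).tendsto_subseq (x := fun k => (w k, d k)) fun k => ⟨hwK k, hdD k⟩
  have hWφ : Tendsto (w ∘ φ) atTop (𝓝 W) := (continuous_fst.tendsto _).comp hlim
  have hdφ : Tendsto (d ∘ φ) atTop (𝓝 x) := (continuous_snd.tendsto _).comp hlim
  have hzφ : Tendsto (z ∘ φ) atTop (𝓝 x) := by
    simpa [Function.comp_def] using (hzd.comp hφ.tendsto_atTop).add hdφ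
  have hcd : Continuous fun p : (ι → ℝ) × (ι → ℝ) => p.1 ⬝ᵥ p.2 :=
    continuous_fst.dotProduct continuous_snd
  have hdot : ∀ {u v : ℕ → ι → ℝ} {a b : ι → ℝ}, Tendsto u atTop (𝓝 a) → Tendsto v atTop (𝓝 b) →
      Tendsto (fun k => u k ⬝ᵥ v k) atTop (𝓝 (a ⬝ᵥ b)) := fun hu hv =>
    (hcd.tendsto _).comp (hu.prodMk_nhds hv)
  set ν := (1 / σ) • (W - x) with hν
  have hxν : x + σ • ν = W := by
    rw [hν, smul_smul, mul_one_div_cancel hσ.ne', one_smul, add_sub_cancel]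
  have hKKT : IsKKTPair C D c x ν := by
    refine ⟨hCc.mem_of_tendsto hzφ (Eventually.of_forall fun k => hzC _), hxD,
      fun y hy => ?_, fun y hy => ?_⟩
    · have h1 := hdot (tendsto_const_nhds (x := c) |>.add ((hdφ.sub hWφ).const_smul (1 / σ)))
        (tendsto_const_nhds (x := y) |>.sub hdφ)
      have h2 := ge_of_tendsto h1 (Eventually.of_forall fun k => hd (φ k) y hy)
      rwa [show c - ν = c + (1 / σ) • (x - W) by rw [hν]; module]
    · have h1 := hdot (hzφ.sub ((hdφ.const_smul (2 : ℝ)).sub hWφ))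
        (tendsto_const_nhds (x := y) |>.sub hzφ)
      have h2 := ge_of_tendsto h1 (Eventually.of_forall fun k => hz (φ k) y hy)
      rw [show x - ((2 : ℝ) • x - W) = W - x by module] at h2
      rw [hν, smul_dotProduct]
      exact mul_nonneg (one_div_pos.2 hσ).le h2
  have hsq : Tendsto (fun k => (w k - W) ⬝ᵥ (w k - W)) atTop (𝓝 0) := by
    have ha := hanti hKKT
    rw [hxν] at ha
    rw [tendsto_iff_tendsto_subseq_of_antitone ha hφ.tendsto_atTop]
    simpa only [sub_self, dotProduct_zero, Function.comp_def] using hdot (hWφ.sub_const W) (hWφ.sub_const W)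
  have hwlim : Tendsto w atTop (𝓝 W) := by
    simpa using (tendsto_zero_of_dotProduct_self hsq).add_const W
  have hdlim : Tendsto d atTop (𝓝 x) := by
    have h0 : Tendsto (fun k => d k - x) atTop (𝓝 0) := by
      refine tendsto_zero_of_dotProduct_self (squeeze_zero
        (fun k => dotProduct_self_nonneg_real _) (fun k => ?_) hsq)
      have h1 := hKKT.prox_monotone hσ (hdD k) (hd k)
      rw [hxν] at h1
      have h2 := dotProduct_self_nonneg_real ((w k - W) - (d k - x))
      rw [dotProduct_sub, sub_dotProduct _ _ (w k - W), sub_dotProduct _ _ (d k - x),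
        dotProduct_comm (d k - x) (w k - W)] at h2
      linarith
    simpa using h0.add_const x
  refine ⟨x, ν, hKKT, hdlim, ?_, (hwlim.sub hdlim).const_smul _⟩
  simpa using hzd.add hdlim

end DouglasRachford

theorem OccD.isPolyhedron {S A : ℕ} (γ : ℝ) (P : Matrix (Fin S × Fin A) (Fin S) ℝ)
    (ρ : Fin S → ℝ) : IsPolyhedron (OccD S A γ P ρ) := by
  let a : Fin S → Module.Dual ℝ (Fin S × Fin A → ℝ) := fun s =>
    (∑ i, LinearMap.proj (s, i)) - γ • ∑ p, P p s • LinearMap.proj p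
  refine (congrArg IsPolyhedron ?_).mpr ((IsPolyhedron.of_forall_le (J := Fin S × Fin A)
    (fun p => (LinearMap.proj p : Module.Dual ℝ (Fin S × Fin A → ℝ))) 0).inter
    (IsPolyhedron.of_forall_eq a fun s => (1 - γ) * ρ s))
  ext d
  simp [OccD, a, sub_eq_iff_eq_add]

theorem OccD.isCompact {S A : ℕ} {γ : ℝ} (hγ1 : γ < 1) {P : Matrix (Fin S × Fin A) (Fin S) ℝ}
    (hP : RowStochastic P) {ρ : Fin S → ℝ} (hρ1 : ∑ s, ρ s = 1) :
    IsCompact (OccD S A γ P ρ) := by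
  have hcl : IsClosed (OccD S A γ P ρ) := by
    have h : OccD S A γ P ρ = (⋂ p, {d | 0 ≤ d p}) ∩
        ⋂ s, {d | ∑ a, d (s, a) = (1 - γ) * ρ s + γ * ∑ p : Fin S × Fin A, P p s * d p} := by
      ext d
      simp [OccD]
    rw [h]
    refine (isClosed_iInter fun p => isClosed_le continuous_const (continuous_apply p)).inter
      (isClosed_iInter fun s => isClosed_eq (by fun_prop) (by fun_prop))
  refine (isCompact_univ_pi fun _ : Fin S × Fin A => 
    isCompact_Icc (a := (0 : ℝ)) (b := 1)).of_isClosed_subset hcl fun d hd p _ => ⟨hd.1 p, ?_⟩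
  have htot : ∑ q, d q = 1 := by
    have h1 := Finset.sum_congr rfl fun s (_ : s ∈ Finset.univ) => hd.2 s
    rw [← Fintype.sum_prod_type, Finset.sum_add_distrib, ← Finset.mul_sum, ← Finset.mul_sum, hρ1,
      Finset.sum_comm] at h1
    simp only [← Finset.sum_mul, hP.2, one_mul] at h1
    have h2 : (1 - γ) * (∑ q, d q - 1) = 0 := by linarith
    have h3 := (mul_eq_zero.1 h2).resolve_left (by linarith)
    linarith
  rw [← htot]
  exact Finset.single_le_sum (fun q _ => hd.1 q) (Finset.mem_univ p)

/-- under a constraint qualification (strict feasibility, or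
polyhedrality plus feasibility), the Douglas–Rachford iterates converge to a
primal-dual solution of the convex-constrained MDP. -/
theorem dra_converges_feasible
    (S A : ℕ) (hS : 0 < S) (hA : 0 < A)
    (γ : ℝ) (hγ0 : 0 < γ) (hγ1 : γ < 1)
    (P : Matrix (Fin S × Fin A) (Fin S) ℝ) (hP : RowStochastic P)
    (ρ : Fin S → ℝ) (hρ0 : ∀ s, 0 ≤ ρ s) (hρ1 : ∑ s, ρ s = 1)
    (c : (Fin S × Fin A) → ℝ) (σ : ℝ) (hσ : 0 < σ)
    (C : Set ((Fin S × Fin A) → ℝ))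
    (hCne : C.Nonempty) (hCclosed : IsClosed C) (hCconvex : Convex ℝ C)
    (hcq : (OccD S A γ P ρ ∩ intrinsicInterior ℝ C).Nonempty ∨
      ((∃ (m : ℕ) (E : Matrix (Fin m) (Fin S × Fin A) ℝ) (b : Fin m → ℝ),
          C = {d | ∀ i, E.mulVec d i ≤ b i}) ∧
        (OccD S A γ P ρ ∩ C).Nonempty))
    (w0 : (Fin S × Fin A) → ℝ)
    (d z ν wseq : ℕ → (Fin S × Fin A) → ℝ)
    (hw0 : wseq 0 = w0)
    (hd : ∀ k : ℕ, d k ∈ OccD S A γ P ρ ∧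
      ∀ d' ∈ OccD S A γ P ρ,
        regObj σ c (wseq k) (d k) ≤ regObj σ c (wseq k) d')
    (hν : ∀ k : ℕ, ν k = (1 / σ) • (wseq k - d k))
    (hz : ∀ k : ℕ, z k ∈ C ∧
      ∀ z' ∈ C,
        eucNorm (z k - ((2 : ℝ) • d k - wseq k)) ≤
          eucNorm (z' - ((2 : ℝ) • d k - wseq k)))
    (hw : ∀ k : ℕ, wseq (k + 1) = wseq k + (z k - d k)) :
    ∃ (dstar νstar : (Fin S × Fin A) → ℝ),
      dstar ∈ C ∩ OccD S A γ P ρ ∧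
      (∀ d' ∈ C ∩ OccD S A γ P ρ, ∑ p, c p * dstar p ≤ ∑ p, c p * d' p) ∧
      Tendsto d atTop (𝓝 dstar) ∧
      Tendsto z atTop (𝓝 dstar) ∧
      Tendsto ν atTop (𝓝 νstar) ∧
      (∀ d' ∈ OccD S A γ P ρ,
        (∑ p, c p * dstar p) + ∑ p, νstar p * (d' p - dstar p) ≤
          ∑ p, c p * d' p) ∧
      (∀ z' ∈ C, 0 ≤ ∑ p, νstar p * (z' p - dstar p)) := by
  have hDc : IsCompact (OccD S A γ P ρ) := OccD.isCompact hγ1 hP hρ1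
  have hDpoly : IsPolyhedron (OccD S A γ P ρ) := OccD.isPolyhedron γ P ρ
  have hne : (C ∩ OccD S A γ P ρ).Nonempty := by
    rcases hcq with ⟨x, hxD, hxC⟩ | ⟨-, x, hxD, hxC⟩
    exacts [⟨x, intrinsicInterior_subset hxC, hxD⟩, ⟨x, hxC, hxD⟩]
  obtain ⟨x, ⟨hxC, hxD⟩, hmin⟩ := (hDc.inter_left hCclosed).exists_isMinOn hne
    (f := fun y => c ⬝ᵥ y) (continuous_const.dotProduct continuous_id).continuousOn
  have hf : ∀ y ∈ C ∩ OccD S A γ P ρ, dotProductBilin ℝ ℝ c x ≤ dotProductBilin ℝ ℝ c y :=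
    fun y hy => hmin hy
  obtain ⟨ν₀, h₀⟩ : ∃ ν₀, IsKKTPair C (OccD S A γ P ρ) c x ν₀ := by
    refine IsKKTPair.of_exists_split hxC hxD ?_
    rcases hcq with ⟨x₀, hx₀D, hx₀C⟩ | ⟨⟨m, E, b, rfl⟩, -⟩
    · exact hDpoly.exists_split_of_mem_intrinsicInterior hCconvex hx₀C hx₀D hxC hxD _ hf
    · have hCpoly : IsPolyhedron {d | ∀ i, E.mulVec d i ≤ b i} := by
        convert IsPolyhedron.of_forall_le
          (fun i => -(LinearMap.proj i).comp E.mulVecLin) (-b) using 1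
        ext y
        simp
      exact hCpoly.exists_split hDpoly hxC hxD _ hf
  have hdVI : ∀ k, ∀ y ∈ OccD S A γ P ρ, 0 ≤ (c + (1 / σ) • (d k - wseq k)) ⬝ᵥ (y - d k) := by
    intro k y hy
    have h := dotProduct_nonneg_of_isMinOn hDpoly.convex c (wseq k) (d k) (1 / (2 * σ)) (hd k).1
      (fun y hy => by
        have := (hd k).2 y hy
        rwa [regObj, regObj, eucNorm_sq, eucNorm_sq] at this) y hy
    rwa [show 2 * (1 / (2 * σ)) = 1 / σ by field_simp] at h
  have hzVI : ∀ k, ∀ y ∈ C, 0 ≤ (z k - ((2 : ℝ) • d k - wseq k)) ⬝ᵥ (y - z k) := by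
    intro k y hy
    have h := dotProduct_nonneg_of_isMinOn hCconvex 0 ((2 : ℝ) • d k - wseq k) (z k) 1 (hz k).1
      (fun y hy => by
        have := pow_le_pow_left₀ (Real.sqrt_nonneg _) ((hz k).2 y hy) 2
        change eucNorm _ ^ 2 ≤ _ at this
        rw [eucNorm_sq, eucNorm_sq] at this
        simpa only [zero_dotProduct, zero_add, one_mul] using this) y hy
    rw [zero_add, smul_dotProduct, smul_eq_mul] at h
    linarith
  obtain ⟨dstar, νstar, hKKT, hdlim, hzlim, hνlim⟩ := douglasRachford_tendsto hσ hCclosed hDc h₀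
    (fun k => (hd k).1) hdVI (fun k => (hz k).1) hzVI hw
  obtain ⟨hC, hD, hνD, hνC⟩ := hKKT
  refine ⟨dstar, νstar, ⟨hC, hD⟩, fun y hy => ?_, hdlim, hzlim, ?_, fun y hy => ?_, hνC⟩
  · have h1 := hνD y hy.2
    have h2 := hνC y hy.1
    rw [sub_dotProduct, dotProduct_sub c] at h1
    change c ⬝ᵥ dstar ≤ c ⬝ᵥ y
    linarith
  · rwa [funext hν]
  · have h1 := hνD y hy
    rw [sub_dotProduct, dotProduct_sub c] at h1
    change c ⬝ᵥ dstar + νstar ⬝ᵥ (y - dstar) ≤ c ⬝ᵥ y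
    linarith
end

section
/- Let S and A be positive integers, γ ∈ (0,1), P ∈ ℝ^{SA×S} row-stochastic, ρ ∈ ℝ^S a probability vector, Ξ = 1_A ⊗ I_S, c ∈ ℝ^{SA}, σ > 0, let D be the occupancy polytope, and let C ⊆ ℝ^{SA} be any nonempty, closed, convex set. Given w_0 ∈ ℝ^{SA}, define the Douglas–Rachford iterates: d_k is the unique minimizer of c^⊤ d + (1/(2σ))‖d − w_k‖² over D; z_k is the unique nearest point of C to 2d_k − w_k; w_{k+1} = w_k + (z_k − d_k). Then d_{k+1} − d_k → 0, the sequence (d_k, z_k) is bounded, and every limit point (d̄, z̄) of (d_k, z_k) satisfies d̄ ∈ D, z̄ ∈ C, and ‖d̄ − z̄‖ ≤ ‖d − z‖ for all d ∈ D and z ∈ C. -/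
open Matrix Filter Topology

open scoped RealInnerProductSpace

theorem exists_best_approximation_pair {E : Type*} [NormedAddCommGroup E] [ProperSpace E]
    {D C : Set E} (hD : IsCompact D) (hDne : D.Nonempty) (hC : IsClosed C) (hCne : C.Nonempty) :
    ∃ p ∈ D, ∃ q ∈ C, ∀ x ∈ D, ∀ y ∈ C, ‖p - q‖ ≤ ‖x - y‖ := by
  obtain ⟨p, hp, hmin⟩ := hD.exists_isMinOn hDne (Metric.continuous_infDist_pt C).continuousOn
  obtain ⟨q, hq, hpq⟩ := hC.exists_infDist_eq_dist hCne p
  refine ⟨p, hp, q, hq, fun x hx y hy => ?_⟩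
  rw [← dist_eq_norm, ← dist_eq_norm, ← hpq]
  exact (hmin hx).trans (Metric.infDist_le_dist_of_mem hy)

theorem MapClusterPt.eq_of_tendsto_comp {α X Y : Type*} [TopologicalSpace X] [TopologicalSpace Y]
    [T2Space Y] {F : Filter α} {u : α → X} {x : X} {f : X → Y} {y : Y} (hx : MapClusterPt x F u)
    (hf : Continuous f) (hy : Tendsto (fun a => f (u a)) F (𝓝 y)) : f x = y := by
  have hcl : MapClusterPt (f x) F (fun a => f (u a)) := hx.tendsto_comp (hf.tendsto x)
  have : (𝓝 (f x) ⊓ Filter.map (fun a => f (u a)) F).NeBot := hcl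
  exact tendsto_nhds_unique (f := id) (tendsto_id.mono_left inf_le_left)
    (le_trans inf_le_right hy)

section DouglasRachford

variable {E : Type*} [NormedAddCommGroup E] [InnerProductSpace ℝ E]

theorem inner_le_zero_of_forall_norm_le {K : Set E} (hK : Convex ℝ K) {u x : E} (hx : x ∈ K)
    (h : ∀ y ∈ K, ‖x - u‖ ≤ ‖y - u‖) : ∀ y ∈ K, ⟪u - x, y - x⟫ ≤ 0 := by
  refine (norm_eq_iInf_iff_real_inner_le_zero hK hx).1 (le_antisymm ?_ ?_)
  · have : Nonempty K := ⟨⟨x, hx⟩⟩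
    refine le_ciInf fun y => ?_
    rw [norm_sub_rev u x, norm_sub_rev u y]
    exact h y y.2
  · exact ciInf_le ⟨0, by rintro _ ⟨y, rfl⟩; exact norm_nonneg _⟩ (⟨x, hx⟩ : K)

/-- If the increments of a sequence are asymptotically constant, then so are its averages over
windows of a fixed length. -/
theorem tendsto_sub_smul_sub_zero {w u : ℕ → E} (hw : ∀ k, w (k + 1) = w k - u k)
    (hu : Tendsto (fun k => u (k + 1) - u k) atTop (𝓝 0)) (m : ℕ) :
    Tendsto (fun n => w n - w (n + m) - (m : ℝ) • u n) atTop (𝓝 0) := by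
  have hum : ∀ m : ℕ, Tendsto (fun n => u (n + m) - u n) atTop (𝓝 0) := by
    intro m
    induction m with
    | zero => simp
    | succ m ih =>
      have := (hu.comp (tendsto_add_atTop_nat m)).add ih
      rw [add_zero] at this
      refine this.congr fun n => ?_
      simp only [Function.comp_apply, ← add_assoc]
      abel
  induction m with
  | zero => simp
  | succ m ih =>
    have := ih.add (hum m)
    rw [add_zero] at this
    refine this.congr fun n => ?_
    rw [← add_assoc, hw (n + m)]
    push_cast
    rw [add_smul, one_smul]
    abel

/-- Convergence in norm to the norm of the element of least norm implies convergence. -/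
theorem tendsto_of_tendsto_norm_of_inner_nonneg {u : ℕ → E} {v : E}
    (hv : ∀ k, 0 ≤ ⟪v, u k - v⟫) (h : Tendsto (fun k => ‖u k‖) atTop (𝓝 ‖v‖)) :
    Tendsto u atTop (𝓝 v) := by
  rw [tendsto_iff_norm_sub_tendsto_zero]
  have h2 : Tendsto (fun k => ‖u k‖ ^ 2 - ‖v‖ ^ 2) atTop (𝓝 0) := by
    rw [← sub_self (‖v‖ ^ 2)]
    exact (h.pow 2).sub_const _
  have h3 : Tendsto (fun k => ‖u k - v‖ ^ 2) atTop (𝓝 0) := by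
    refine squeeze_zero (fun _ => by positivity) (fun k => ?_) h2
    have := hv k
    rw [inner_sub_right, real_inner_self_eq_norm_sq] at this
    rw [norm_sub_sq_real, real_inner_comm]
    linarith
  simpa [Real.sqrt_sq (norm_nonneg _)] using h3.sqrt

theorem le_zero_of_forall_mul_le_add_sqrt {η a K : ℝ}
    (ha : 0 ≤ a)
    (h : ∀ m : ℕ, m * η ≤ a + √(a ^ 2 + 2 * K * m)) : η ≤ 0 := by
  by_contra! hη
  obtain ⟨m, hm⟩ := exists_nat_gt (max (a / η) ((2 * a * η + 2 * K) / η ^ 2))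
  have h1 := (le_max_left _ _).trans_lt hm
  have h2 := (le_max_right _ _).trans_lt hm
  rw [div_lt_iff₀ hη] at h1
  rw [div_lt_iff₀ (by positivity)] at h2
  have h3 := h m
  have h4 : (m * η - a) ^ 2 ≤ a ^ 2 + 2 * K * m := by
    rw [← Real.le_sqrt' (by linarith)]
    linarith
  have hpos : (0 : ℝ) < m := ((div_nonneg ha hη.le).trans (le_max_left _ _)).trans_lt hm
  nlinarith

theorem norm_sq_firmly_nonexpansive {a δ ζ : E} :
    ‖a + (ζ - δ)‖ ^ 2 + ‖δ - ζ‖ ^ 2 + 2 * (⟪a - δ, δ⟫ + ⟪(2 : ℝ) • δ - a - ζ, ζ⟫) = ‖a‖ ^ 2 := by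
  simp only [← real_inner_self_eq_norm_sq, inner_add_left, inner_add_right, inner_sub_left,
    inner_sub_right, inner_smul_left, real_inner_comm δ a, real_inner_comm ζ a, real_inner_comm ζ δ]
  simp
  ring

/-- Douglas–Rachford iterates for `D` (tilted by the linear functional `c`) and `C`, described by
their variational inequalities: if `(p, q)` is a best approximation pair, then the gaps `d k - z k`
converge to `p - q` and the increments of `d` vanish, whether or not `D` and `C` intersect. -/
theorem douglasRachford_tendsto_s18 {D C : Set E} {c : E} {d z w : ℕ → E} {p q : E}
    (hdD : ∀ k, d k ∈ D) (hzC : ∀ k, z k ∈ C)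
    (hd : ∀ k, ∀ x ∈ D, ⟪w k - c - d k, x - d k⟫ ≤ 0)
    (hz : ∀ k, ∀ y ∈ C, ⟪(2 : ℝ) • d k - w k - z k, y - z k⟫ ≤ 0)
    (hw : ∀ k, w (k + 1) = w k + (z k - d k))
    (hp : p ∈ D) (hq : q ∈ C)
    (hvD : ∀ x ∈ D, 0 ≤ ⟪p - q, x - p⟫) (hvC : ∀ y ∈ C, 0 ≤ ⟪p - q, q - y⟫)
    {K : ℝ} (hK : ∀ x ∈ D, ⟪c, p - x⟫ ≤ K) :
    Tendsto (fun k => d (k + 1) - d k) atTop (𝓝 0) ∧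
      Tendsto (fun k => d k - z k) atTop (𝓝 (p - q)) := by
  set v := p - q with hv
  set u : ℕ → E := fun k => d k - z k with hu
  have hwu : ∀ k, w (k + 1) = w k - u k := fun k => by rw [hw]; simp only [hu]; abel
  have hvu : ∀ k, 0 ≤ ⟪v, u k - v⟫ := fun k => by
    have h : u k - v = (d k - p) + (q - z k) := by simp only [hu, hv]; abel
    rw [h, inner_add_right]
    exact add_nonneg (hvD _ (hdD k)) (hvC _ (hzC k))
  have hmonD : ∀ k l, 0 ≤ ⟪(w k - w l) - (d k - d l), d k - d l⟫ := fun k l => by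
    have h1 := hd k _ (hdD l)
    have h2 := hd l _ (hdD k)
    simp only [inner_sub_left, inner_sub_right] at h1 h2 ⊢
    linarith
  have hmonC : ∀ k l,
      0 ≤ ⟪(2 : ℝ) • (d k - d l) - (w k - w l) - (z k - z l), z k - z l⟫ := fun k l => by
    have h1 := hz k _ (hzC l)
    have h2 := hz l _ (hzC k)
    simp only [inner_sub_left, inner_sub_right, smul_sub] at h1 h2 ⊢
    linarith
  have hfirm : ∀ k l, ‖w (k + 1) - w (l + 1)‖ ^ 2 + ‖u k - u l‖ ^ 2
      + 2 * ⟪(w k - w l) - (d k - d l), d k - d l⟫ ≤ ‖w k - w l‖ ^ 2 := fun k l => by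
    have h := norm_sq_firmly_nonexpansive (a := w k - w l) (δ := d k - d l) (ζ := z k - z l)
    have h1 : w k - w l + (z k - z l - (d k - d l)) = w (k + 1) - w (l + 1) := by
      rw [hw, hw]; abel
    have h2 : d k - d l - (z k - z l) = u k - u l := by simp only [hu]; abel
    rw [h1, h2] at h
    linarith [hmonC k l]
  have hne : ∀ m n, ‖w n - w (n + m)‖ ≤ ‖w 0 - w m‖ := fun m n => by
    induction n with
    | zero => simp
    | succ n ih =>
      refine le_trans (le_of_sq_le_sq ?_ (norm_nonneg _)) ih
      have := hfirm n (n + m)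
      rw [add_right_comm n 1 m]
      nlinarith [hmonD n (n + m), sq_nonneg ‖u n - u (n + m)‖]
  have hdecr : ∀ k, ‖u (k + 1)‖ ^ 2 + ‖u k - u (k + 1)‖ ^ 2
      + 2 * ⟪u k - (d k - d (k + 1)), d k - d (k + 1)⟫ ≤ ‖u k‖ ^ 2 := fun k => by
    have h := hfirm k (k + 1)
    have h1 : ∀ j, w j - w (j + 1) = u j := fun j => by rw [hwu]; abel
    rwa [h1, h1] at h
  have hmonu : ∀ k, 0 ≤ ⟪u k - (d k - d (k + 1)), d k - d (k + 1)⟫ := fun k => by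
    have h := hmonD k (k + 1)
    have h1 : w k - w (k + 1) = u k := by rw [hwu]; abel
    rwa [h1] at h
  have hanti : Antitone fun k => ‖u k‖ := antitone_nat_of_succ_le fun k =>
    le_of_sq_le_sq (by nlinarith [hdecr k, hmonu k, sq_nonneg ‖u k - u (k + 1)‖]) (norm_nonneg _)
  obtain ⟨L, hL⟩ : ∃ L, Tendsto (fun k => ‖u k‖) atTop (𝓝 L) :=
    ⟨_, tendsto_atTop_ciInf hanti ⟨0, by rintro _ ⟨k, rfl⟩; exact norm_nonneg _⟩⟩
  have hgap : Tendsto (fun k => ‖u k‖ ^ 2 - ‖u (k + 1)‖ ^ 2) atTop (𝓝 0) := by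
    simpa using (hL.pow 2).sub ((hL.comp (tendsto_add_atTop_nat 1)).pow 2)
  have hΔu : Tendsto (fun k => u (k + 1) - u k) atTop (𝓝 0) := by
    rw [tendsto_zero_iff_norm_tendsto_zero]
    have h : Tendsto (fun k => ‖u (k + 1) - u k‖ ^ 2) atTop (𝓝 0) := by
      refine squeeze_zero (fun _ => by positivity) (fun k => ?_) hgap
      rw [norm_sub_rev]
      linarith [hdecr k, hmonu k]
    simpa [Real.sqrt_sq (norm_nonneg _)] using h.sqrt
  have hdrift : ∀ m : ℕ, ‖w m + (m : ℝ) • v - q‖ ^ 2 ≤ ‖w 0 - q‖ ^ 2 + 2 * K * m := fun m => by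
    induction m with
    | zero => simp
    | succ m ih =>
      set X := w (m + 1) + ((m + 1 : ℕ) : ℝ) • v - q with hX
      have hstep : w m + (m : ℝ) • v - q = X + (u m - v) := by
        rw [hX, hwu]; push_cast; rw [add_smul, one_smul]; abel
      have h1 : -⟪w (m + 1) - q, u m - v⟫ ≤ K := by
        have e1 := hd m p hp
        have e2 := hz m q hq
        have e3 := hK _ (hdD m)
        have e4 := hvC _ (hzC m)
        rw [hw]
        simp only [hu, hv, two_smul, inner_add_left, inner_sub_left, inner_sub_right]
          at e1 e2 e3 e4 ⊢
        have := real_inner_comm (d m) (z m)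
        have := real_inner_comm p q
        have := real_inner_comm p (z m)
        have := real_inner_comm p (d m)
        have := real_inner_comm q (d m)
        have := real_inner_comm q (z m)
        linarith
      have h2 : -⟪X, u m - v⟫ ≤ K := by
        have h3 : X = (w (m + 1) - q) + ((m + 1 : ℕ) : ℝ) • v := by rw [hX]; abel
        rw [h3, inner_add_left, real_inner_smul_left]
        have := mul_nonneg (Nat.cast_nonneg (α := ℝ) (m + 1)) (hvu m)
        linarith
      rw [hstep, norm_add_sq_real] at ih
      push_cast
      nlinarith [sq_nonneg ‖u m - v‖]
  have hLv : L ≤ ‖v‖ := by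
    refine sub_nonpos.1 (le_zero_of_forall_mul_le_add_sqrt (K := K) (norm_nonneg (w 0 - q))
      fun m => ?_)
    have h1 : (m : ℝ) * L ≤ ‖w 0 - w m‖ := by
      have ht := (tendsto_sub_smul_sub_zero hwu hΔu m).norm.add_const ‖w 0 - w m‖
      rw [norm_zero, zero_add] at ht
      refine le_of_tendsto_of_tendsto' (hL.const_mul (m : ℝ)) ht fun n => ?_
      calc (m : ℝ) * ‖u n‖ = ‖(m : ℝ) • u n‖ := by rw [norm_smul]; simp
        _ = ‖(w n - w (n + m)) - (w n - w (n + m) - (m : ℝ) • u n)‖ := by rw [sub_sub_cancel]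
        _ ≤ ‖w n - w (n + m)‖ + ‖w n - w (n + m) - (m : ℝ) • u n‖ := norm_sub_le _ _
        _ ≤ _ := by linarith [hne m n]
    have h2 : ‖w 0 - w m‖ ≤ ‖w 0 - q‖ + ‖w m + (m : ℝ) • v - q‖ + m * ‖v‖ := by
      have e : w 0 - w m = (w 0 - q) - (w m + (m : ℝ) • v - q) + (m : ℝ) • v := by abel
      have e' : ‖(m : ℝ) • v‖ = m * ‖v‖ := by rw [norm_smul]; simp
      rw [e, ← e']
      exact (norm_add_le _ _).trans (by gcongr; exact norm_sub_le _ _)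
    have h3 := Real.le_sqrt_of_sq_le (hdrift m)
    linarith
  have hvL : ∀ k, ‖v‖ ≤ ‖u k‖ := fun k => by
    refine le_of_sq_le_sq ?_ (norm_nonneg _)
    have h := norm_add_sq_real v (u k - v)
    rw [add_sub_cancel] at h
    nlinarith [hvu k, sq_nonneg ‖u k - v‖]
  have hLeq : L = ‖v‖ := le_antisymm hLv (ge_of_tendsto' hL hvL)
  have huv : Tendsto u atTop (𝓝 v) := tendsto_of_tendsto_norm_of_inner_nonneg hvu (hLeq ▸ hL)
  refine ⟨?_, huv⟩
  have huv0 : Tendsto (fun k => u k - v) atTop (𝓝 0) := by simpa using huv.sub_const v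
  have hinner : Tendsto (fun k => ⟪v, u k - v⟫) atTop (𝓝 0) := by
    simpa using (tendsto_const_nhds (x := v)).inner huv0
  have hvd : Tendsto (fun k => ⟪v, d k - p⟫) atTop (𝓝 0) := by
    refine squeeze_zero (fun k => hvD _ (hdD k)) (fun k => ?_) hinner
    have h : u k - v = (d k - p) + (q - z k) := by simp only [hu, hv]; abel
    rw [h, inner_add_right]
    linarith [hvC _ (hzC k)]
  have hbound : Tendsto (fun k => ‖u k - v‖ ^ 2 + 2 * (⟪v, d k - p⟫ - ⟪v, d (k + 1) - p⟫))
      atTop (𝓝 0) := by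
    simpa using (huv0.norm.pow 2).add
      ((hvd.sub (hvd.comp (tendsto_add_atTop_nat 1))).const_mul 2)
  rw [tendsto_zero_iff_norm_tendsto_zero]
  have h : Tendsto (fun k => ‖d (k + 1) - d k‖ ^ 2) atTop (𝓝 0) := by
    refine squeeze_zero (fun _ => by positivity) (fun k => ?_) hbound
    rw [norm_sub_rev, ← inner_sub_right, sub_sub_sub_cancel_right]
    have h1 := hmonu k
    rw [inner_sub_left, real_inner_self_eq_norm_sq] at h1
    have h2 := norm_sub_sq_real (u k - v) (d k - d (k + 1))
    rw [inner_sub_left] at h2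
    nlinarith [sq_nonneg ‖u k - v - (d k - d (k + 1))‖]
  simpa [Real.sqrt_sq (norm_nonneg _)] using h.sqrt

end DouglasRachford

theorem eucNorm_eq_norm_toLp {ι : Type*} [Fintype ι] (x : ι → ℝ) :
    eucNorm x = ‖WithLp.toLp 2 x‖ := by
  simp [eucNorm, EuclideanSpace.norm_eq]

theorem regObj_eq {ι : Type*} [Fintype ι] {σ : ℝ} (hσ : 0 < σ) (c w d : ι → ℝ) :
    regObj σ c w d = (1 / (2 * σ)) * eucNorm (d - (w - σ • c)) ^ 2
      + ((∑ i, c i * w i) - σ / 2 * ∑ i, c i ^ 2) := by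
  have h : ∀ x : ι → ℝ, eucNorm x ^ 2 = ∑ i, x i ^ 2 := fun x =>
    Real.sq_sqrt (Finset.sum_nonneg fun i _ => sq_nonneg _)
  simp only [regObj, h, Finset.mul_sum, ← Finset.sum_add_distrib, ← Finset.sum_sub_distrib]
  refine Finset.sum_congr rfl fun i _ => ?_
  simp only [Pi.sub_apply, Pi.smul_apply, smul_eq_mul]
  field_simp
  ring

section OccupancyPolytope

variable {S A : ℕ} {γ : ℝ} {P : Matrix (Fin S × Fin A) (Fin S) ℝ} {ρ : Fin S → ℝ}

theorem sum_eq_one_of_mem_OccD (hγ1 : γ < 1) (hP : RowStochastic P) (hρ1 : ∑ s, ρ s = 1)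
    {d : Fin S × Fin A → ℝ} (hd : d ∈ OccD S A γ P ρ) : ∑ p, d p = 1 := by
  have h : ∑ p, d p = (1 - γ) + γ * ∑ p, d p := by
    calc ∑ p, d p = ∑ s, ((1 - γ) * ρ s + γ * ∑ p, P p s * d p) := by
          rw [Fintype.sum_prod_type]
          exact Finset.sum_congr rfl fun s _ => hd.2 s
      _ = _ := by
          rw [Finset.sum_add_distrib, ← Finset.mul_sum, ← Finset.mul_sum, hρ1, mul_one,
            Finset.sum_comm]
          simp only [← Finset.sum_mul, hP.2, one_mul]
  nlinarith

theorem isClosed_OccD : IsClosed (OccD S A γ P ρ) := by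
  refine IsClosed.and (?_ : IsClosed {d | _}) (?_ : IsClosed {d | _})
  · simp only [Set.ofPred_forall]
    exact isClosed_iInter fun p => isClosed_le (by fun_prop) (by fun_prop)
  · simp only [Set.ofPred_forall]
    exact isClosed_iInter fun s => isClosed_eq (by fun_prop) (by fun_prop)

theorem convex_OccD : Convex ℝ (OccD S A γ P ρ) := by
  intro x hx y hy a b ha hb hab
  refine ⟨fun p => ?_, fun s => ?_⟩
  · exact add_nonneg (mul_nonneg ha (hx.1 p)) (mul_nonneg hb (hy.1 p))
  · have h1 := hx.2 s
    have h2 := hy.2 s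
    simp only [Pi.add_apply, Pi.smul_apply, smul_eq_mul, mul_add, Finset.sum_add_distrib,
      mul_left_comm (P _ s), ← Finset.mul_sum, h1, h2]
    linear_combination ((1 - γ) * ρ s) * hab

theorem isCompact_OccD (hγ1 : γ < 1) (hP : RowStochastic P) (hρ1 : ∑ s, ρ s = 1) :
    IsCompact (OccD S A γ P ρ) := by
  refine (isCompact_univ_pi fun _ => isCompact_Icc (a := (0 : ℝ)) (b := 1)).of_isClosed_subset
    isClosed_OccD fun d hd p _ => ⟨hd.1 p, ?_⟩
  rw [← sum_eq_one_of_mem_OccD hγ1 hP hρ1 hd]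
  exact Finset.single_le_sum (fun i _ => hd.1 i) (Finset.mem_univ p)

end OccupancyPolytope

/-- for any nonempty closed convex C (no feasibility
assumption), the Douglas–Rachford iterates satisfy d_{k+1} − d_k → 0, the
sequence (d_k, z_k) is bounded, and every limit point is a best
approximation pair between D and C. -/
theorem dra_infeasible_limit_points
    (S A : ℕ) (hS : 0 < S) (hA : 0 < A)
    (γ : ℝ) (hγ0 : 0 < γ) (hγ1 : γ < 1)
    (P : Matrix (Fin S × Fin A) (Fin S) ℝ) (hP : RowStochastic P)
    (ρ : Fin S → ℝ) (hρ0 : ∀ s, 0 ≤ ρ s) (hρ1 : ∑ s, ρ s = 1)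
    (c : (Fin S × Fin A) → ℝ) (σ : ℝ) (hσ : 0 < σ)
    (C : Set ((Fin S × Fin A) → ℝ))
    (hCne : C.Nonempty) (hCclosed : IsClosed C) (hCconvex : Convex ℝ C)
    (w0 : (Fin S × Fin A) → ℝ)
    (d z wseq : ℕ → (Fin S × Fin A) → ℝ)
    (hw0 : wseq 0 = w0)
    (hd : ∀ k : ℕ, d k ∈ OccD S A γ P ρ ∧
      ∀ d' ∈ OccD S A γ P ρ,
        regObj σ c (wseq k) (d k) ≤ regObj σ c (wseq k) d')
    (hz : ∀ k : ℕ, z k ∈ C ∧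
      ∀ z' ∈ C,
        eucNorm (z k - ((2 : ℝ) • d k - wseq k)) ≤
          eucNorm (z' - ((2 : ℝ) • d k - wseq k)))
    (hw : ∀ k : ℕ, wseq (k + 1) = wseq k + (z k - d k)) :
    Tendsto (fun k => d (k + 1) - d k) atTop (𝓝 0) ∧
    (∃ R : ℝ, ∀ k : ℕ, eucNorm (d k) + eucNorm (z k) ≤ R) ∧
    ∀ dbar zbar : (Fin S × Fin A) → ℝ,
      MapClusterPt (dbar, zbar) atTop (fun k => (d k, z k)) →
        dbar ∈ OccD S A γ P ρ ∧ zbar ∈ C ∧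
          ∀ d' ∈ OccD S A γ P ρ, ∀ z' ∈ C,
            eucNorm (dbar - zbar) ≤ eucNorm (d' - z') := by
  let D' : Set (EuclideanSpace ℝ (Fin S × Fin A)) := WithLp.ofLp ⁻¹' OccD S A γ P ρ
  let C' : Set (EuclideanSpace ℝ (Fin S × Fin A)) := WithLp.ofLp ⁻¹' C
  have hDcpt : IsCompact D' :=
    (PiLp.homeomorph 2 fun _ : Fin S × Fin A => ℝ).isCompact_preimage.2 (isCompact_OccD hγ1 hP hρ1)
  have hDconv : Convex ℝ D' :=
    convex_OccD.linear_preimage (WithLp.linearEquiv 2 ℝ (Fin S × Fin A → ℝ)).toLinearMap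
  have hCcl : IsClosed C' := hCclosed.preimage (PiLp.continuous_ofLp 2 _)
  have hCconv : Convex ℝ C' :=
    hCconvex.linear_preimage (WithLp.linearEquiv 2 ℝ (Fin S × Fin A → ℝ)).toLinearMap
  have hCne' : C'.Nonempty := hCne.imp' (WithLp.toLp 2) fun x hx => hx
  obtain ⟨p, hp, q, hq, hpq⟩ :=
    exists_best_approximation_pair hDcpt ⟨WithLp.toLp 2 (d 0), (hd 0).1⟩ hCcl hCne'
  have hvD : ∀ x ∈ D', 0 ≤ ⟪p - q, x - p⟫ := fun x hx => by
    have h := inner_le_zero_of_forall_norm_le hDconv hp (fun y hy => hpq y hy q hq) x hx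
    rw [← neg_sub p q, inner_neg_left] at h
    linarith
  have hvC : ∀ y ∈ C', 0 ≤ ⟪p - q, q - y⟫ := fun y hy => by
    have h := inner_le_zero_of_forall_norm_le hCconv hq
      (fun y hy => by rw [norm_sub_rev q, norm_sub_rev y]; exact hpq p hp y hy) y hy
    rw [← neg_sub q y, inner_neg_right] at h
    linarith
  obtain ⟨K, hK⟩ := hDcpt.bddAbove_image
    (f := fun x => ⟪WithLp.toLp 2 (σ • c), p - x⟫) (by fun_prop)
  obtain ⟨hΔ, hgap⟩ := douglasRachford_tendsto_s18 (D := D') (C := C') (c := WithLp.toLp 2 (σ • c))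
    (d := fun k => WithLp.toLp 2 (d k)) (z := fun k => WithLp.toLp 2 (z k))
    (w := fun k => WithLp.toLp 2 (wseq k)) (fun k => (hd k).1) (fun k => (hz k).1)
    (fun k => inner_le_zero_of_forall_norm_le hDconv (hd k).1 fun y hy => by
      have h := (hd k).2 _ hy
      rw [regObj_eq hσ, regObj_eq hσ, add_le_add_iff_right,
        mul_le_mul_iff_right₀ (by positivity)] at h
      simpa only [eucNorm_eq_norm_toLp, WithLp.toLp_sub, WithLp.toLp_smul, WithLp.toLp_ofLp]
        using le_of_sq_le_sq h (Real.sqrt_nonneg _))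
    (fun k => inner_le_zero_of_forall_norm_le hCconv (hz k).1 fun y hy => by
      simpa only [eucNorm_eq_norm_toLp, WithLp.toLp_sub, WithLp.toLp_smul, WithLp.toLp_ofLp]
        using (hz k).2 _ hy)
    (fun k => by rw [hw]; rfl) hp hq hvD hvC (fun x hx => hK (Set.mem_image_of_mem _ hx))
  refine ⟨(PiLp.continuous_ofLp 2 fun _ : Fin S × Fin A => ℝ).tendsto 0 |>.comp hΔ, ?_, ?_⟩
  · obtain ⟨R₁, hR₁⟩ := hDcpt.isBounded.exists_norm_le
    obtain ⟨R₂, hR₂⟩ := hgap.norm.bddAbove_range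
    refine ⟨R₁ + (R₁ + R₂), fun k => ?_⟩
    have h1 := hR₁ (WithLp.toLp 2 (d k)) (hd k).1
    have h2 := hR₂ (Set.mem_range_self k)
    have h3 := norm_sub_le (WithLp.toLp 2 (d k)) (WithLp.toLp 2 (d k) - WithLp.toLp 2 (z k))
    rw [sub_sub_cancel] at h3
    rw [eucNorm_eq_norm_toLp, eucNorm_eq_norm_toLp]
    linarith
  · intro dbar zbar hcl
    have hmem : (dbar, zbar) ∈ OccD S A γ P ρ ×ˢ C :=
      (isClosed_OccD.prod hCclosed).mem_of_mapClusterPt hcl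
        (Eventually.of_forall fun k => ⟨(hd k).1, (hz k).1⟩)
    refine ⟨hmem.1, hmem.2, fun d' hd' z' hz' => ?_⟩
    have hcont : Continuous fun x : (Fin S × Fin A → ℝ) × (Fin S × Fin A → ℝ) =>
        eucNorm (x.1 - x.2) := by
      unfold eucNorm
      fun_prop
    have hlim : Tendsto (fun k => eucNorm (d k - z k)) atTop (𝓝 ‖p - q‖) := by
      simpa only [eucNorm_eq_norm_toLp, WithLp.toLp_sub] using hgap.norm
    have heq : eucNorm (dbar - zbar) = ‖p - q‖ := hcl.eq_of_tendsto_comp hcont hlim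
    rw [heq, eucNorm_eq_norm_toLp]
    exact hpq (WithLp.toLp 2 d') hd' (WithLp.toLp 2 z') hz'
end
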